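/- Let a, b > 0 and N ∈ ℕ. If 0 < ν ≤ 1/2, then ν^{2ν} · K( (ν√(a/b))^{1/2^{N}}, 2 )^{β_N(1−2ν)} · a^ν b^{1−ν} + ν²(√a − √b)² + S_N( 1−2ν; b, ν√(ab) ) ≤ ν² a + (1−ν)² b. If 1/2 ≤ ν < 1, then (1−ν)^{2−2ν} · K( ((1−ν)√(b/a))^{1/2^{N}}, 2 )^{β_N(2ν−1)} · a^ν b^{1−ν} + (1−ν)²(√a − √b)² + S_N( 2ν−1; a, (1−ν)√(ab) ) ≤ ν² a + (1−ν)² b. -/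

import Mathlib

open Real Finset

noncomputable def kj (j : ℕ) (ν : ℝ) : ℤ := ⌊(2:ℝ)^(j-1) * ν⌋

noncomputable def rj (j : ℕ) (ν : ℝ) : ℤ := ⌊(2:ℝ)^j * ν⌋

noncomputable def sj (j : ℕ) (ν : ℝ) : ℝ :=
  (-1:ℝ)^(rj j ν) * (2:ℝ)^(j-1) * ν
    + (-1:ℝ)^(rj j ν + 1) * (⌊((rj j ν : ℝ) + 1)/2⌋ : ℤ)

noncomputable def SS (N : ℕ) (ν a b : ℝ) : ℝ :=
  ∑ j ∈ Finset.Icc 1 N, sj j ν *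
    ((b ^ ((2:ℝ)^(j-1) - (kj j ν : ℝ)) * a ^ ((kj j ν : ℝ))) ^ ((1:ℝ)/2^j)
      - (a ^ ((kj j ν : ℝ) + 1) * b ^ ((2:ℝ)^(j-1) - (kj j ν : ℝ) - 1)) ^ ((1:ℝ)/2^j))^2

noncomputable def Kc (t : ℝ) : ℝ := (t + 1)^2 / (4 * t)

noncomputable def betaN (N : ℕ) (ν : ℝ) : ℝ :=
  min (1 + (⌊(2:ℝ)^N * ν⌋ : ℝ) - (2:ℝ)^N * ν) ((2:ℝ)^N * ν - (⌊(2:ℝ)^N * ν⌋ : ℝ))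

noncomputable def geoMean (a b t : ℝ) : ℝ := a ^ t * b ^ (1 - t)

lemma geoMean_pos {a b : ℝ} (ha : 0 < a) (hb : 0 < b) (t : ℝ) : 0 < geoMean a b t := by
  unfold geoMean; positivity

lemma geoMean_rpow_mul_rpow {a b : ℝ} (ha : 0 < a) (hb : 0 < b) (s t x : ℝ) :
    geoMean a b s ^ x * geoMean a b t ^ (1 - x) = geoMean a b (x * s + (1 - x) * t) := by
  unfold geoMean
  rw [mul_rpow (by positivity) (by positivity), mul_rpow (by positivity) (by positivity),
    ← rpow_mul ha.le, ← rpow_mul hb.le, ← rpow_mul ha.le, ← rpow_mul hb.le,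
    mul_mul_mul_comm, ← rpow_add ha, ← rpow_add hb]
  ring_nf

lemma geoMean_div_geoMean {a b : ℝ} (ha : 0 < a) (hb : 0 < b) (s t : ℝ) :
    geoMean a b s / geoMean a b t = (a / b) ^ (s - t) := by
  unfold geoMean
  rw [mul_div_mul_comm, ← rpow_sub ha, ← rpow_sub hb, div_rpow ha.le hb.le, div_eq_mul_inv,
    ← rpow_neg hb.le]
  ring_nf

lemma rpow_half_mul_rpow_half {a b : ℝ} (ha : 0 < a) (hb : 0 < b) (s t : ℝ) :
    geoMean a b s ^ (1 / 2 : ℝ) * geoMean a b t ^ (1 / 2 : ℝ) = geoMean a b ((s + t) / 2) := by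
  have h := geoMean_rpow_mul_rpow ha hb s t (1 / 2)
  rw [show (1 : ℝ) - 1 / 2 = 1 / 2 by norm_num] at h
  rw [h]
  ring_nf

lemma rpow_half_sq {x : ℝ} (hx : 0 < x) : (x ^ (1 / 2 : ℝ)) ^ 2 = x := by
  rw [← rpow_natCast, ← rpow_mul hx.le]
  norm_num

lemma Kc_inv {t : ℝ} (ht : 0 < t) : Kc t⁻¹ = Kc t := by
  unfold Kc
  field_simp
  ring

lemma Kc_div {a b : ℝ} (ha : 0 < a) (hb : 0 < b) :
    Kc (a / b) = ((a + b) / 2) ^ 2 / (a * b) := by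
  unfold Kc
  field_simp
  ring

lemma Kc_rpow_mul_le_of_le_half {a b x : ℝ} (ha : 0 < a) (hb : 0 < b) (h0 : 0 ≤ x)
    (h1 : x ≤ 1 / 2) :
    Kc (a / b) ^ x * (a ^ x * b ^ (1 - x)) ≤ x * a + (1 - x) * b := by
  have key := geom_mean_le_arith_mean2_weighted (w₁ := 2 * x) (w₂ := 1 - 2 * x)
    (p₁ := (a + b) / 2) (p₂ := b) (by linarith) (by linarith) (by positivity) hb.le (by ring)
  have e : Kc (a / b) ^ x * (a ^ x * b ^ (1 - x)) = ((a + b) / 2) ^ (2 * x) * b ^ (1 - 2 * x) := by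
    rw [Kc_div ha hb, div_rpow (by positivity) (by positivity), mul_rpow ha.le hb.le,
      rpow_mul (by positivity), rpow_two, show 1 - x = x + (1 - 2 * x) by ring, rpow_add hb]
    have := rpow_pos_of_pos ha x
    have := rpow_pos_of_pos hb x
    field_simp
  rw [e]
  linarith

lemma Kc_rpow_min_mul_le {a b x : ℝ} (ha : 0 < a) (hb : 0 < b) (h0 : 0 ≤ x) (h1 : x ≤ 1) :
    Kc (a / b) ^ min (1 - x) x * (a ^ x * b ^ (1 - x)) ≤ x * a + (1 - x) * b := by
  rcases le_total x (1 / 2) with h | h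
  · rw [min_eq_right (by linarith)]
    exact Kc_rpow_mul_le_of_le_half ha hb h0 h
  · rw [min_eq_left (by linarith)]
    have key := Kc_rpow_mul_le_of_le_half (x := 1 - x) hb ha (by linarith) (by linarith)
    rw [← inv_div, Kc_inv (by positivity), sub_sub_cancel, mul_comm (b ^ _)] at key
    linarith

/-- Interpolation of `a ^ t * b ^ (1 - t)` at `t = ν` between the neighbouring
multiples of `2 ^ (-N)`. -/
noncomputable def dyadicInterp (N : ℕ) (ν a b : ℝ) : ℝ :=
  Int.fract (2 ^ N * ν) * geoMean a b ((⌊2 ^ N * ν⌋ + 1) / 2 ^ N)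
    + (1 - Int.fract (2 ^ N * ν)) * geoMean a b (⌊2 ^ N * ν⌋ / 2 ^ N)

lemma rpow_dyadic_eq_geoMean {a b : ℝ} (ha : 0 < a) (hb : 0 < b) (N : ℕ) (k : ℝ) :
    (b ^ ((2:ℝ) ^ N - k) * a ^ k) ^ ((1:ℝ) / 2 ^ (N + 1))
      = geoMean a b (k / 2 ^ N) ^ (1 / 2 : ℝ) := by
  unfold geoMean
  rw [mul_rpow (by positivity) (by positivity), mul_rpow (by positivity) (by positivity),
    ← rpow_mul ha.le, ← rpow_mul hb.le, ← rpow_mul ha.le, ← rpow_mul hb.le, mul_comm]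
  congr 2 <;> field_simp <;> ring

lemma floor_and_sj_succ (N : ℕ) (ν : ℝ) :
    (⌊2 ^ (N + 1) * ν⌋ = 2 * ⌊2 ^ N * ν⌋ ∧ sj (N + 1) ν = Int.fract (2 ^ N * ν)) ∨
    (⌊2 ^ (N + 1) * ν⌋ = 2 * ⌊2 ^ N * ν⌋ + 1 ∧ sj (N + 1) ν = 1 - Int.fract (2 ^ N * ν)) := by
  have hk := Int.floor_add_fract ((2:ℝ) ^ N * ν)
  have h0 := Int.fract_nonneg ((2:ℝ) ^ N * ν)
  have h1 := Int.fract_lt_one ((2:ℝ) ^ N * ν)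
  set k := ⌊(2:ℝ) ^ N * ν⌋
  set x := Int.fract ((2:ℝ) ^ N * ν)
  have e : (2:ℝ) ^ (N + 1) * ν = 2 * (k + x) := by rw [hk]; ring
  rcases lt_or_ge x (1 / 2) with h | h
  · left
    have hr : ⌊(2:ℝ) ^ (N + 1) * ν⌋ = 2 * k := by
      rw [e, Int.floor_eq_iff]; push_cast; constructor <;> linarith
    refine ⟨hr, ?_⟩
    have hf : ⌊((2 * k : ℤ) + 1 : ℝ) / 2⌋ = k := by
      rw [Int.floor_eq_iff]; push_cast; constructor <;> linarith
    unfold sj rj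
    rw [hr, hf, (even_two_mul k).neg_one_zpow, (even_two_mul k).add_one.neg_one_zpow,
      Nat.add_sub_cancel, one_mul, ← hk]
    ring
  · right
    have hr : ⌊(2:ℝ) ^ (N + 1) * ν⌋ = 2 * k + 1 := by
      rw [e, Int.floor_eq_iff]; push_cast; constructor <;> linarith
    refine ⟨hr, ?_⟩
    have hf : ⌊((2 * k + 1 : ℤ) + 1 : ℝ) / 2⌋ = k + 1 := by
      rw [Int.floor_eq_iff]; push_cast; constructor <;> linarith
    unfold sj rj
    rw [hr, hf, (even_two_mul k).add_one.neg_one_zpow,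
      (even_two_mul k).add_one.add_one.neg_one_zpow, Nat.add_sub_cancel, one_mul, mul_assoc, ← hk]
    push_cast
    ring

lemma dyadicInterp_succ {a b : ℝ} (ha : 0 < a) (hb : 0 < b) (N : ℕ) (ν : ℝ) :
    dyadicInterp N ν a b = dyadicInterp (N + 1) ν a b + sj (N + 1) ν *
      (geoMean a b (⌊2 ^ N * ν⌋ / 2 ^ N) ^ (1 / 2 : ℝ)
        - geoMean a b ((⌊2 ^ N * ν⌋ + 1) / 2 ^ N) ^ (1 / 2 : ℝ)) ^ 2 := by
  have hx : Int.fract ((2:ℝ) ^ (N + 1) * ν)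
      = 2 * (⌊(2:ℝ) ^ N * ν⌋ + Int.fract ((2:ℝ) ^ N * ν)) - ⌊(2:ℝ) ^ (N + 1) * ν⌋ := by
    rw [Int.floor_add_fract, Int.fract]; ring
  rw [sub_sq, rpow_half_sq (geoMean_pos ha hb _), rpow_half_sq (geoMean_pos ha hb _), mul_assoc 2,
    rpow_half_mul_rpow_half ha hb]
  unfold dyadicInterp
  rw [hx]
  rcases floor_and_sj_succ N ν with ⟨hr, hs⟩ | ⟨hr, hs⟩
  all_goals
    rw [hr, hs]
    generalize ⌊(2:ℝ) ^ N * ν⌋ = k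
    generalize Int.fract ((2:ℝ) ^ N * ν) = x
    push_cast
    have e1 : ((k:ℝ) / 2 ^ N + (k + 1) / 2 ^ N) / 2 = (2 * k + 1) / 2 ^ (N + 1) := by
      field_simp; ring
    have e2 : (2 * (k:ℝ)) / 2 ^ (N + 1) = k / 2 ^ N := by field_simp; ring
    have e3 : (2 * (k:ℝ) + 1 + 1) / 2 ^ (N + 1) = (k + 1) / 2 ^ N := by field_simp; ring
    simp only [e1, e2, e3]
    ring

lemma dyadicInterp_zero {ν : ℝ} (a b : ℝ) (h0 : 0 ≤ ν) (h1 : ν < 1) :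
    dyadicInterp 0 ν a b = ν * a + (1 - ν) * b := by
  have hf : ⌊ν⌋ = 0 := Int.floor_eq_zero_iff.2 ⟨h0, h1⟩
  simp [dyadicInterp, geoMean, hf, Int.fract]

lemma dyadicInterp_add_SS {a b ν : ℝ} (ha : 0 < a) (hb : 0 < b) (h0 : 0 ≤ ν) (h1 : ν < 1)
    (N : ℕ) : dyadicInterp N ν a b + SS N ν a b = ν * a + (1 - ν) * b := by
  induction N with
  | zero => simp [dyadicInterp_zero a b h0 h1, SS]
  | succ N ih =>
    rw [← ih, dyadicInterp_succ ha hb N ν]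
    unfold SS
    rw [Finset.sum_Icc_succ_top (by omega)]
    simp only [Nat.add_sub_cancel, kj]
    rw [rpow_dyadic_eq_geoMean ha hb, mul_comm (a ^ _), sub_sub, rpow_dyadic_eq_geoMean ha hb]
    ring

lemma refined_young {a b ν : ℝ} (ha : 0 < a) (hb : 0 < b) (h0 : 0 ≤ ν) (h1 : ν < 1) (N : ℕ) :
    Kc ((a / b) ^ ((1:ℝ) / 2 ^ N)) ^ betaN N ν * (a ^ ν * b ^ (1 - ν)) + SS N ν a b
      ≤ ν * a + (1 - ν) * b := by
  rw [← dyadicInterp_add_SS ha hb h0 h1 N]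
  have key := Kc_rpow_min_mul_le (x := Int.fract ((2:ℝ) ^ N * ν))
    (geoMean_pos ha hb ((⌊(2:ℝ) ^ N * ν⌋ + 1) / 2 ^ N))
    (geoMean_pos ha hb (⌊(2:ℝ) ^ N * ν⌋ / 2 ^ N)) (Int.fract_nonneg _) (Int.fract_lt_one _).le
  rw [geoMean_rpow_mul_rpow ha hb, geoMean_div_geoMean ha hb, ← sub_div, add_sub_cancel_left] at key
  have e : Int.fract ((2:ℝ) ^ N * ν) * ((⌊(2:ℝ) ^ N * ν⌋ + 1) / 2 ^ N)
      + (1 - Int.fract ((2:ℝ) ^ N * ν)) * (⌊(2:ℝ) ^ N * ν⌋ / 2 ^ N) = ν := by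
    rw [Int.fract]; field_simp; ring
  have eβ : min (1 - Int.fract ((2:ℝ) ^ N * ν)) (Int.fract ((2:ℝ) ^ N * ν)) = betaN N ν := by
    unfold betaN Int.fract
    congr 1; ring
  rw [e, eβ] at key
  unfold geoMean at key
  unfold dyadicInterp geoMean
  linarith

lemma refined_young_sqrt {a b ν : ℝ} (ha : 0 < a) (hb : 0 < b) (h0 : 0 < ν) (h1 : ν ≤ 1 / 2)
    (N : ℕ) :
    ν ^ (2*ν) * Kc ((ν * Real.sqrt (a/b)) ^ ((1:ℝ)/2^N)) ^ (betaN N (1 - 2*ν))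
          * (a ^ ν * b ^ (1 - ν))
        + ν^2 * (Real.sqrt a - Real.sqrt b)^2
        + SS N (1 - 2*ν) b (ν * Real.sqrt (a*b))
        ≤ ν^2 * a + (1 - ν)^2 * b := by
  have key := refined_young (ν := 1 - 2 * ν) (b := ν * √(a * b)) hb (by positivity)
    (by linarith) (by linarith) N
  have hsa := Real.sq_sqrt ha.le
  have hsb := Real.sq_sqrt hb.le
  have hpa := Real.sqrt_pos.2 ha
  have hpb := Real.sqrt_pos.2 hb
  have eK : b / (ν * √(a * b)) = (ν * √(a / b))⁻¹ := by
    rw [Real.sqrt_mul ha.le, Real.sqrt_div ha.le]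
    nth_rewrite 1 [← hsb]
    field_simp
  have eM : b ^ (1 - 2 * ν) * (ν * √(a * b)) ^ (1 - (1 - 2 * ν))
      = ν ^ (2 * ν) * (a ^ ν * b ^ (1 - ν)) := by
    rw [sub_sub_cancel, mul_rpow h0.le (by positivity), rpow_mul (Real.sqrt_nonneg _) 2, rpow_two,
      Real.sq_sqrt (by positivity), mul_rpow ha.le hb.le,
      show 1 - ν = (1 - 2 * ν) + ν by ring, rpow_add hb]
    ring
  rw [eK, Real.inv_rpow (by positivity), Kc_inv (by positivity), eM] at key
  rw [Real.sqrt_mul ha.le] at key ⊢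
  linear_combination key + ν ^ 2 * hsa + ν ^ 2 * hsb

theorem stmt13 (a b ν : ℝ) (ha : 0 < a) (hb : 0 < b) (N : ℕ) :
    (0 < ν → ν ≤ 1/2 →
      ν ^ (2*ν) * Kc ((ν * Real.sqrt (a/b)) ^ ((1:ℝ)/2^N)) ^ (betaN N (1 - 2*ν))
          * (a ^ ν * b ^ (1 - ν))
        + ν^2 * (Real.sqrt a - Real.sqrt b)^2
        + SS N (1 - 2*ν) b (ν * Real.sqrt (a*b))
        ≤ ν^2 * a + (1 - ν)^2 * b) ∧
    (1/2 ≤ ν → ν < 1 →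
      (1 - ν) ^ (2 - 2*ν) * Kc (((1 - ν) * Real.sqrt (b/a)) ^ ((1:ℝ)/2^N)) ^ (betaN N (2*ν - 1))
          * (a ^ ν * b ^ (1 - ν))
        + (1 - ν)^2 * (Real.sqrt a - Real.sqrt b)^2
        + SS N (2*ν - 1) a ((1 - ν) * Real.sqrt (a*b))
        ≤ ν^2 * a + (1 - ν)^2 * b) := by
  
  refine ⟨fun h0 h1 => refined_young_sqrt ha hb h0 h1 N, fun h0 h1 => ?_⟩
  have key := refined_young_sqrt (ν := 1 - ν) hb ha (by linarith) (by linarith) N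
  have e1 : 1 - 2 * (1 - ν) = 2 * ν - 1 := by ring
  have e2 : 2 * (1 - ν) = 2 - 2 * ν := by ring
  rw [e1, e2, sub_sub_cancel, mul_comm b a, mul_comm (b ^ _)] at key
  linarith
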